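/- Let x₀ > 0 and θ > 0 with M_{x₀} < 2, let σ ≤ 0, and let A ∈ ℂ. Define S_{σ,0}(x) = e^(−2i(1+iσ)φ(x)) and S_{σ,n+1} = K_σ(S_{σ,n}) for n ≥ 0. Then ‖S_{σ,n}‖_{L^∞(x₀,∞)} ≤ (M_{x₀}/2)^n for all n, the series Σ_{n≥0} S_{σ,n} converges uniformly on [x₀, ∞), and the unique bounded continuous solution of the equation S(x) = A e^(−2i(1+iσ)φ(x)) + K_σ(S)(x) on [x₀, ∞) is S = A · Σ_{n≥0} S_{σ,n}. Moreover, setting s_{σ,n}(x) = S_{σ,n}(x) e^(2i(1+iσ)φ(x)), one has ‖s_{σ,n}‖_{L^∞(x₀,∞)} ≤ (M_{x₀}/2)^n for all n, and ‖Σ_{n≥N+1} s_{σ,n}‖_{L^∞(x₀,∞)} ≤ (1 − M_{x₀}/2)^(−1) (M_{x₀}/2)^(N+1) for all N. -/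

import Mathlib

open MeasureTheory Set Filter Topology

noncomputable section

/-- The wave speed profile `c(x) = (1 + θ (x₊)^α)^(-1/2)`. -/
def spd (α θ x : ℝ) : ℝ := (1 + θ * (max x 0) ^ α) ^ (-(1 / 2) : ℝ)

/-- The WKB amplitude `b(x) = c(x)^(1/2)`. -/
def amp (α θ x : ℝ) : ℝ := spd α θ x ^ ((1 : ℝ) / 2)

/-- The WKB phase `φ(x) = ∫₀ˣ c(y)⁻¹ dy`. -/
def phase (α θ x : ℝ) : ℝ := ∫ y in (0:ℝ)..x, (spd α θ y)⁻¹

/-- `M(x) = c(x)^(1/2) (c^(1/2))''(x)` for `x > 0`, and `0` for `x ≤ 0`. -/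
def Mfun (α θ x : ℝ) : ℝ :=
  if 0 < x then
    spd α θ x ^ ((1 : ℝ) / 2) * deriv (deriv (fun y => spd α θ y ^ ((1 : ℝ) / 2))) x
  else 0

/-- `M_{x₀} = ∫_{x₀}^∞ |M(x)| dx`. -/
def Mtail (α θ x₀ : ℝ) : ℝ := ∫ x in Ioi x₀, |Mfun α θ x|

/-- The Volterra operator `K_σ`. -/
def Kop (α θ x₀ σ : ℝ) (f : ℝ → ℂ) (x : ℝ) : ℂ :=
  (2 * Complex.I * (1 + Complex.I * (σ : ℂ)))⁻¹ *
    ((∫ y in x₀..x, (Mfun α θ y : ℂ) * f y *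
        Complex.exp (-2 * Complex.I * (1 + Complex.I * (σ : ℂ)) *
          ((phase α θ x - phase α θ y : ℝ) : ℂ))) +
      ∫ y in Ioi x, (Mfun α θ y : ℂ) * f y)

/-- The right-going WKB wave `v^> = b e^{-iφ}`. -/
def vplus (α θ x : ℝ) : ℂ := (amp α θ x : ℂ) * Complex.exp (-Complex.I * (phase α θ x : ℂ))

/-- The left-going WKB wave `v^< = b e^{iφ}`. -/
def vminus (α θ x : ℝ) : ℂ := (amp α θ x : ℂ) * Complex.exp (Complex.I * (phase α θ x : ℂ))

/-- `S` is a bounded continuous solution on `[x₀,∞)` of `S = e^{-2iφ} + K₀ S`. -/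
def IsVolterraSol (α θ x₀ : ℝ) (S : ℝ → ℂ) : Prop :=
  (∃ C, ∀ x ∈ Ici x₀, ‖S x‖ ≤ C) ∧ ContinuousOn S (Ici x₀) ∧
    ∀ x ∈ Ici x₀, S x = Complex.exp (-2 * Complex.I * (phase α θ x : ℂ)) + Kop α θ x₀ 0 S x

/-- `R_{x₀} = (2i)⁻¹ ∫_{x₀}^∞ M S^>`. -/
def Rx (α θ x₀ : ℝ) (S : ℝ → ℂ) : ℂ :=
  (2 * Complex.I)⁻¹ * ∫ x in Ioi x₀, (Mfun α θ x : ℂ) * S x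

/-- Iterates of the Volterra operator: `S_{σ,0} = e^{-2i(1+iσ)φ}`, `S_{σ,n+1} = K_σ S_{σ,n}`. -/
def Sseq (α θ x₀ σ : ℝ) : ℕ → ℝ → ℂ
  | 0 => fun x => Complex.exp (-2 * Complex.I * (1 + Complex.I * (σ : ℂ)) * (phase α θ x : ℂ))
  | n + 1 => Kop α θ x₀ σ (Sseq α θ x₀ σ n)

lemma spd_pos {θ : ℝ} (α : ℝ) (hθ : 0 < θ) (x : ℝ) : 0 < spd α θ x := by
  unfold spd
  have := Real.rpow_nonneg (le_max_right x 0) α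
  positivity

lemma continuous_spd {α θ : ℝ} (hα : 0 < α) (hθ : 0 < θ) : Continuous (spd α θ) := by
  unfold spd
  refine Continuous.rpow_const ?_ fun x => Or.inl ?_
  · exact continuous_const.add (continuous_const.mul
      ((continuous_id.max continuous_const).rpow_const fun x => Or.inr hα.le))
  · have := Real.rpow_nonneg (le_max_right x 0) α
    positivity

lemma continuous_inv_spd {α θ : ℝ} (hα : 0 < α) (hθ : 0 < θ) :
    Continuous fun x => (spd α θ x)⁻¹ :=
  (continuous_spd hα hθ).inv₀ fun x => (spd_pos α hθ x).ne'

lemma continuous_phase {α θ : ℝ} (hα : 0 < α) (hθ : 0 < θ) : Continuous (phase α θ) :=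
  intervalIntegral.continuous_primitive
    (fun a b => (continuous_inv_spd hα hθ).intervalIntegrable a b) 0

lemma monotone_phase {α θ : ℝ} (hα : 0 < α) (hθ : 0 < θ) : Monotone (phase α θ) := by
  intro a b hab
  have hint := fun a b => (continuous_inv_spd hα hθ).intervalIntegrable (μ := volume) a b
  have h : phase α θ b - phase α θ a = ∫ y in a..b, (spd α θ y)⁻¹ :=
    intervalIntegral.integral_interval_sub_left (hint 0 b) (hint 0 a)
  have h' : 0 ≤ ∫ y in a..b, (spd α θ y)⁻¹ :=
    intervalIntegral.integral_nonneg hab fun y _ => (inv_pos.2 (spd_pos α hθ y)).le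
  linarith

lemma phase_nonneg {α θ x : ℝ} (hα : 0 < α) (hθ : 0 < θ) (hx : 0 ≤ x) : 0 ≤ phase α θ x := by
  have h := monotone_phase hα hθ hx
  rwa [phase, intervalIntegral.integral_same] at h

lemma sqrt_spd_eq {α θ y : ℝ} (hθ : 0 < θ) (hy : 0 < y) :
    spd α θ y ^ ((1 : ℝ) / 2) = (1 + θ * y ^ α) ^ (-(1 / 4) : ℝ) := by
  rw [spd, max_eq_left hy.le, ← Real.rpow_mul (by positivity)]
  norm_num

lemma hasDerivAt_base_rpow {θ y : ℝ} (α p : ℝ) (hθ : 0 < θ) (hy : 0 < y) :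
    HasDerivAt (fun z => (1 + θ * z ^ α) ^ p)
      (θ * (α * y ^ (α - 1)) * p * (1 + θ * y ^ α) ^ (p - 1)) y :=
  (((Real.hasDerivAt_rpow_const (Or.inl hy.ne')).const_mul θ).const_add 1).rpow_const
    (Or.inl (by positivity))

lemma deriv_sqrt_spd {α θ y : ℝ} (hθ : 0 < θ) (hy : 0 < y) :
    deriv (fun z => spd α θ z ^ ((1 : ℝ) / 2)) y =
      θ * (α * y ^ (α - 1)) * (-(1 / 4)) * (1 + θ * y ^ α) ^ (-(5 / 4) : ℝ) := by
  have h : (fun z => spd α θ z ^ ((1 : ℝ) / 2)) =ᶠ[𝓝 y]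
      fun z => (1 + θ * z ^ α) ^ (-(1 / 4) : ℝ) := by
    filter_upwards [Ioi_mem_nhds hy] with z hz using sqrt_spd_eq hθ hz
  rw [h.deriv_eq, (hasDerivAt_base_rpow α _ hθ hy).deriv]
  norm_num

lemma Mfun_eq {α θ y : ℝ} (hθ : 0 < θ) (hy : 0 < y) :
    Mfun α θ y = (1 + θ * y ^ α) ^ (-(1 / 4) : ℝ) *
      (θ * (α * ((α - 1) * y ^ (α - 2))) * (-(1 / 4)) * (1 + θ * y ^ α) ^ (-(5 / 4) : ℝ) +
        θ * (α * y ^ (α - 1)) * (-(1 / 4)) *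
          (θ * (α * y ^ (α - 1)) * (-(5 / 4)) * (1 + θ * y ^ α) ^ (-(9 / 4) : ℝ))) := by
  have h : deriv (fun z => spd α θ z ^ ((1 : ℝ) / 2)) =ᶠ[𝓝 y]
      fun z => θ * (α * z ^ (α - 1)) * (-(1 / 4)) * (1 + θ * z ^ α) ^ (-(5 / 4) : ℝ) := by
    filter_upwards [Ioi_mem_nhds hy] with z hz using deriv_sqrt_spd hθ hz
  have hd := ((((Real.hasDerivAt_rpow_const (p := α - 1) (Or.inl hy.ne')).const_mul
    α).const_mul θ).mul_const (-(1 / 4))).mul (hasDerivAt_base_rpow α (-(5 / 4)) hθ hy)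
  rw [Mfun, if_pos hy, sqrt_spd_eq hθ hy, h.deriv_eq]
  refine congrArg _ (hd.deriv.trans ?_)
  norm_num [sub_sub]

lemma continuousOn_Mfun {α θ : ℝ} (hθ : 0 < θ) : ContinuousOn (Mfun α θ) (Ioi 0) := by
  have hr : ∀ p : ℝ, ContinuousOn (fun y : ℝ => y ^ p) (Ioi 0) := fun p =>
    continuousOn_id.rpow_const fun y hy => Or.inl (ne_of_gt hy)
  have hb : ∀ p : ℝ, ContinuousOn (fun y : ℝ => (1 + θ * y ^ α) ^ p) (Ioi 0) := fun p y hy =>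
    (hasDerivAt_base_rpow α p hθ hy).continuousAt.continuousWithinAt
  have h1 := hr (α - 1)
  have h2 := hr (α - 2)
  have h3 := hb (-(1 / 4))
  have h4 := hb (-(5 / 4))
  have h5 := hb (-(9 / 4))
  refine ContinuousOn.congr ?_ fun y hy => Mfun_eq hθ hy
  fun_prop

lemma abs_Mfun_le {α θ y : ℝ} (hα : 0 < α) (hθ : 0 < θ) (hy : 0 < y) :
    |Mfun α θ y| ≤ (α * |α - 1| + α ^ 2) * y ^ (-2 : ℝ) := by
  rw [Mfun_eq hθ hy]
  set w := 1 + θ * y ^ α with hw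
  have hyα : 0 < y ^ α := by positivity
  have hw1 : 1 ≤ w := by have := mul_pos hθ hyα; linarith
  have hw0 : 0 < w := by linarith
  have hle : ∀ p : ℝ, p ≤ 0 → w ^ p ≤ 1 := fun p hp => Real.rpow_le_one_of_one_le_of_nonpos hw1 hp
  have hpos : ∀ p : ℝ, 0 < w ^ p := fun p => Real.rpow_pos_of_pos hw0 p
  have e5 : w ^ (-(5 / 4) : ℝ) = w⁻¹ * w ^ (-(1 / 4) : ℝ) := by
    rw [← Real.rpow_neg_one, ← Real.rpow_add hw0]; norm_num
  have e9 : w ^ (-(9 / 4) : ℝ) = w⁻¹ ^ 2 * w ^ (-(1 / 4) : ℝ) := by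
    rw [← Real.rpow_neg_one, ← Real.rpow_natCast, ← Real.rpow_mul hw0.le, ← Real.rpow_add hw0]
    norm_num
  have y2 : y ^ (α - 2) = y ^ α * y ^ (-2 : ℝ) := by rw [← Real.rpow_add hy]; rfl
  have y1 : y ^ (α - 1) * y ^ (α - 1) = (y ^ α) ^ 2 * y ^ (-2 : ℝ) := by
    rw [← Real.rpow_natCast, ← Real.rpow_mul hy.le, ← Real.rpow_add hy, ← Real.rpow_add hy]
    congr 1; push_cast; ring
  have hq : w ^ (-(1 / 4) : ℝ) ≤ 1 := hle _ (by norm_num)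
  have hq0 := hpos (-(1 / 4))
  set q := w ^ (-(1 / 4) : ℝ)
  set t := θ * y ^ α * w⁻¹ with ht
  have ht0 : 0 ≤ t := by positivity
  have ht1 : t ≤ 1 := by
    rw [ht, ← div_eq_mul_inv, div_le_one hw0]; linarith
  have hY : 0 < y ^ (-2 : ℝ) := by positivity
  set Y := y ^ (-2 : ℝ)
  have key : q * (θ * (α * ((α - 1) * y ^ (α - 2))) * (-(1 / 4)) * w ^ (-(5 / 4) : ℝ) +
        θ * (α * y ^ (α - 1)) * (-(1 / 4)) *
          (θ * (α * y ^ (α - 1)) * (-(5 / 4)) * w ^ (-(9 / 4) : ℝ))) =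
      (-(1 / 4) * (α * (α - 1)) * t + 5 / 16 * α ^ 2 * t ^ 2) * Y * q ^ 2 := by
    rw [e5, e9, y2, ht]
    linear_combination (5 / 16 * θ ^ 2 * α ^ 2 * q ^ 2 * w⁻¹ ^ 2) * y1
  rw [key, abs_mul, abs_mul, abs_of_pos hY, abs_of_pos (by positivity : 0 < q ^ 2)]
  have hq2 : q ^ 2 ≤ 1 := pow_le_one₀ hq0.le hq
  have ht2 : t ^ 2 ≤ 1 := pow_le_one₀ ht0 ht1
  have hc : |-(1 / 4) * (α * (α - 1)) * t + 5 / 16 * α ^ 2 * t ^ 2| ≤ α * |α - 1| + α ^ 2 := by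
    refine (abs_add_le _ _).trans (add_le_add ?_ ?_)
    · rw [abs_mul, abs_mul, abs_mul, abs_of_nonneg ht0, abs_of_pos hα]
      have h0 : 0 ≤ α * |α - 1| := by positivity
      norm_num
      nlinarith
    · rw [abs_of_nonneg (by positivity)]
      nlinarith [sq_nonneg α]
  calc _ ≤ (α * |α - 1| + α ^ 2) * Y * 1 := by gcongr
    _ = _ := mul_one _

lemma integrableOn_Mfun {α θ x₀ : ℝ} (hα : 0 < α) (hθ : 0 < θ) (hx₀ : 0 < x₀) :
    IntegrableOn (Mfun α θ) (Ioi x₀) := by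
  refine Integrable.mono'
    ((integrableOn_Ioi_rpow_of_lt (by norm_num : (-2 : ℝ) < -1) hx₀).const_mul
      (α * |α - 1| + α ^ 2))
    (((continuousOn_Mfun hθ).mono (Ioi_subset_Ioi hx₀.le)).aestronglyMeasurable
      measurableSet_Ioi) ?_
  filter_upwards [ae_restrict_mem measurableSet_Ioi] with y hy
  exact abs_Mfun_le hα hθ (hx₀.trans hy)

lemma integrableOn_Mfun_mul {α θ x₀ C : ℝ} {f : ℝ → ℂ} (hα : 0 < α) (hθ : 0 < θ) (hx₀ : 0 < x₀)
    (hf : ContinuousOn f (Ici x₀)) (hC : ∀ x ∈ Ici x₀, ‖f x‖ ≤ C) :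
    IntegrableOn (fun y => (Mfun α θ y : ℂ) * f y) (Ioi x₀) := by
  refine Integrable.mul_bdd (c := C) (integrableOn_Mfun hα hθ hx₀).ofReal
    ((hf.mono Ioi_subset_Ici_self).aestronglyMeasurable measurableSet_Ioi) ?_
  filter_upwards [ae_restrict_mem measurableSet_Ioi] with y hy using hC y (Ioi_subset_Ici_self hy)

lemma norm_exp_phase (σ t : ℝ) :
    ‖Complex.exp (-2 * Complex.I * (1 + Complex.I * (σ : ℂ)) * (t : ℂ))‖ =
      Real.exp (2 * σ * t) := by
  rw [Complex.norm_exp]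
  simp

lemma norm_inv_two_I_mul_le (σ : ℝ) :
    ‖(2 * Complex.I * (1 + Complex.I * (σ : ℂ)))⁻¹‖ ≤ 1 / 2 := by
  have h : 1 ≤ ‖1 + Complex.I * (σ : ℂ)‖ := by
    simpa using Complex.abs_re_le_norm (1 + Complex.I * (σ : ℂ))
  rw [norm_inv, norm_mul, norm_mul, Complex.norm_I, Complex.norm_two, mul_one, one_div]
  exact inv_anti₀ two_pos (by linarith)

/-- The operator `K_σ` has norm at most `M_{x₀} / 2` in the sup norm weighted by `e^{-2τφ}`, for
every `σ ≤ τ ≤ 0`. -/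
lemma norm_Kop_le {α θ x₀ σ τ C : ℝ} {f : ℝ → ℂ} (hα : 0 < α) (hθ : 0 < θ) (hx₀ : 0 < x₀)
    (hστ : σ ≤ τ) (hτ : τ ≤ 0)
    (hf : ∀ x ∈ Ici x₀, ‖f x‖ ≤ C * Real.exp (2 * τ * phase α θ x)) {x : ℝ} (hx : x ∈ Ici x₀) :
    ‖Kop α θ x₀ σ f x‖ ≤ Mtail α θ x₀ / 2 * C * Real.exp (2 * τ * phase α θ x) := by
  have hx' : x₀ ≤ x := hx
  have hC : 0 ≤ C := nonneg_of_mul_nonneg_left ((norm_nonneg _).trans (hf x hx)) (Real.exp_pos _)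
  have hM : IntegrableOn (fun y => |Mfun α θ y|) (Ioi x₀) := (integrableOn_Mfun hα hθ hx₀).abs
  set B := C * Real.exp (2 * τ * phase α θ x) with hB
  have h1 : ‖∫ y in x₀..x, (Mfun α θ y : ℂ) * f y *
        Complex.exp (-2 * Complex.I * (1 + Complex.I * (σ : ℂ)) *
          ((phase α θ x - phase α θ y : ℝ) : ℂ))‖ ≤ ∫ y in Ioc x₀ x, |Mfun α θ y| * B := by
    rw [intervalIntegral.integral_of_le hx']
    refine norm_integral_le_of_norm_le ((hM.mono_set Ioc_subset_Ioi_self).mul_const B) ?_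
    filter_upwards [ae_restrict_mem measurableSet_Ioc] with y hy
    rw [norm_mul, norm_mul, norm_exp_phase, Complex.norm_real, Real.norm_eq_abs, mul_assoc]
    refine mul_le_mul_of_nonneg_left ?_ (abs_nonneg _)
    have hφ := monotone_phase hα hθ hy.2
    calc _ ≤ C * Real.exp (2 * τ * phase α θ y) *
          Real.exp (2 * σ * (phase α θ x - phase α θ y)) := by gcongr; exact hf y hy.1.le
      _ = C * Real.exp (2 * τ * phase α θ y + 2 * σ * (phase α θ x - phase α θ y)) := by
        rw [mul_assoc, ← Real.exp_add]
      _ ≤ B := by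
        rw [hB]
        gcongr
        nlinarith
  have h2 : ‖∫ y in Ioi x, (Mfun α θ y : ℂ) * f y‖ ≤ ∫ y in Ioi x, |Mfun α θ y| * B := by
    refine norm_integral_le_of_norm_le ((hM.mono_set (Ioi_subset_Ioi hx')).mul_const B) ?_
    filter_upwards [ae_restrict_mem measurableSet_Ioi] with y hy
    rw [norm_mul, Complex.norm_real, Real.norm_eq_abs]
    refine mul_le_mul_of_nonneg_left ?_ (abs_nonneg _)
    refine (hf y (hx'.trans (le_of_lt hy))).trans ?_
    rw [hB]
    have hφ := monotone_phase hα hθ (le_of_lt hy)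
    gcongr ?_ * Real.exp ?_
    nlinarith
  have h3 : (∫ y in Ioc x₀ x, |Mfun α θ y| * B) + ∫ y in Ioi x, |Mfun α θ y| * B =
      Mtail α θ x₀ * B := by
    rw [← setIntegral_union (Ioc_disjoint_Ioi le_rfl) measurableSet_Ioi
      ((hM.mono_set Ioc_subset_Ioi_self).mul_const B)
      ((hM.mono_set (Ioi_subset_Ioi hx')).mul_const B), Ioc_union_Ioi_eq_Ioi hx',
      integral_mul_const, Mtail]
  rw [Kop, norm_mul]
  calc _ ≤ 1 / 2 * (Mtail α θ x₀ * B) := by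
        gcongr
        · exact norm_inv_two_I_mul_le σ
        · exact (norm_add_le _ _).trans (h3 ▸ add_le_add h1 h2)
    _ = _ := by rw [hB]; ring

lemma intervalIntegrable_mul_exp_phase {α θ x₀ x : ℝ} {g : ℝ → ℂ} (hα : 0 < α) (hθ : 0 < θ)
    (z : ℂ) (a : ℝ) (hg : IntegrableOn g (Ioi x₀)) (hx : x₀ ≤ x) :
    IntervalIntegrable (fun y => g y * Complex.exp (z * ((a - phase α θ y : ℝ) : ℂ)))
      volume x₀ x := by
  have hφ := continuous_phase hα hθ
  refine IntervalIntegrable.mul_continuousOn ?_ (Continuous.continuousOn (by fun_prop))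
  rw [intervalIntegrable_iff_integrableOn_Ioc_of_le hx]
  exact hg.mono_set Ioc_subset_Ioi_self

lemma Kop_add {α θ x₀ σ x : ℝ} {f g : ℝ → ℂ} (hα : 0 < α) (hθ : 0 < θ)
    (hf : IntegrableOn (fun y => (Mfun α θ y : ℂ) * f y) (Ioi x₀))
    (hg : IntegrableOn (fun y => (Mfun α θ y : ℂ) * g y) (Ioi x₀)) (hx : x₀ ≤ x) :
    Kop α θ x₀ σ (fun y => f y + g y) x = Kop α θ x₀ σ f x + Kop α θ x₀ σ g x := by
  have h1 : ∀ y, (Mfun α θ y : ℂ) * (f y + g y) = Mfun α θ y * f y + Mfun α θ y * g y :=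
    fun y => mul_add _ _ _
  simp only [Kop, h1, add_mul _ _ (Complex.exp _)]
  rw [intervalIntegral.integral_add (intervalIntegrable_mul_exp_phase hα hθ _ _ hf hx)
      (intervalIntegrable_mul_exp_phase hα hθ _ _ hg hx),
    integral_add (hf.mono_set (Ioi_subset_Ioi hx)) (hg.mono_set (Ioi_subset_Ioi hx))]
  ring

lemma Kop_const_mul (α θ x₀ σ x : ℝ) (a : ℂ) (f : ℝ → ℂ) :
    Kop α θ x₀ σ (fun y => a * f y) x = a * Kop α θ x₀ σ f x := by
  simp only [Kop, mul_left_comm _ a, mul_assoc a, intervalIntegral.integral_const_mul,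
    integral_const_mul]
  ring

lemma Kop_sub {α θ x₀ σ x : ℝ} {f g : ℝ → ℂ} (hα : 0 < α) (hθ : 0 < θ)
    (hf : IntegrableOn (fun y => (Mfun α θ y : ℂ) * f y) (Ioi x₀))
    (hg : IntegrableOn (fun y => (Mfun α θ y : ℂ) * g y) (Ioi x₀)) (hx : x₀ ≤ x) :
    Kop α θ x₀ σ (fun y => f y - g y) x = Kop α θ x₀ σ f x - Kop α θ x₀ σ g x := by
  have h := Kop_add (σ := σ) hα hθ hf
    (g := fun y => -1 * g y) (by simpa using hg.neg) hx
  rw [Kop_const_mul] at h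
  simpa [← sub_eq_add_neg] using h

lemma continuousOn_primitive_Ici {x₀ : ℝ} {g : ℝ → ℂ}
    (hg : ∀ x, x₀ ≤ x → IntervalIntegrable g volume x₀ x) :
    ContinuousOn (fun x => ∫ y in x₀..x, g y) (Ici x₀) := by
  intro x hx
  have hx1 : x₀ ≤ x + 1 := by have : x₀ ≤ x := hx; linarith
  have h := intervalIntegral.continuousOn_primitive_interval' (hg _ hx1) left_mem_uIcc
  rw [uIcc_of_le hx1] at h
  refine (h x ⟨hx, by linarith⟩).mono_of_mem_nhdsWithin ?_
  rw [← Ici_inter_Iic]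
  exact inter_mem_nhdsWithin _ (Iic_mem_nhds (by linarith))

lemma continuousOn_Kop {α θ x₀ σ : ℝ} {f : ℝ → ℂ} (hα : 0 < α) (hθ : 0 < θ)
    (hf : IntegrableOn (fun y => (Mfun α θ y : ℂ) * f y) (Ioi x₀)) :
    ContinuousOn (Kop α θ x₀ σ f) (Ici x₀) := by
  have hφ := continuous_phase hα hθ
  set z := -2 * Complex.I * (1 + Complex.I * (σ : ℂ)) with hz
  have hi : ∀ x, x₀ ≤ x → IntervalIntegrable (fun y => (Mfun α θ y : ℂ) * f y) volume x₀ x := by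
    intro x hx
    rw [intervalIntegrable_iff_integrableOn_Ioc_of_le hx]
    exact hf.mono_set Ioc_subset_Ioi_self
  have c1 := continuousOn_primitive_Ici fun x hx =>
    intervalIntegrable_mul_exp_phase hα hθ z 0 hf hx
  have c2 := continuousOn_primitive_Ici hi
  have c3 : ContinuousOn (fun x => Complex.exp (z * (phase α θ x : ℂ))) (Ici x₀) :=
    Continuous.continuousOn (by fun_prop)
  refine ContinuousOn.congr ((continuousOn_const
    (c := (2 * Complex.I * (1 + Complex.I * (σ : ℂ)))⁻¹)).mul ((c3.mul c1).add
    ((continuousOn_const (c := ∫ y in Ioi x₀, (Mfun α θ y : ℂ) * f y)).sub c2)))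
    (fun x hx => ?_)
  rw [Kop]
  congr 2
  · rw [Pi.mul_apply, ← intervalIntegral.integral_const_mul]
    refine intervalIntegral.integral_congr fun y _ => ?_
    rw [mul_left_comm, ← Complex.exp_add, hz]
    push_cast
    ring_nf
  · rw [Pi.sub_apply, intervalIntegral.integral_of_le hx, eq_sub_iff_add_eq', ← setIntegral_union
      (Ioc_disjoint_Ioi le_rfl) measurableSet_Ioi (hf.mono_set Ioc_subset_Ioi_self)
      (hf.mono_set (Ioi_subset_Ioi hx)), Ioc_union_Ioi_eq_Ioi hx]

lemma Mtail_nonneg (α θ x₀ : ℝ) : 0 ≤ Mtail α θ x₀ :=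
  integral_nonneg fun _ => abs_nonneg _

lemma norm_Sseq_le_mul_exp {α θ x₀ σ : ℝ} (hα : 0 < α) (hθ : 0 < θ) (hx₀ : 0 < x₀)
    (hσ : σ ≤ 0) (n : ℕ) :
    ∀ x ∈ Ici x₀, ‖Sseq α θ x₀ σ n x‖ ≤
      (Mtail α θ x₀ / 2) ^ n * Real.exp (2 * σ * phase α θ x) := by
  induction n with
  | zero => intro x _; rw [Sseq, norm_exp_phase, pow_zero, one_mul]
  | succ n ih =>
    intro x hx
    rw [Sseq, pow_succ']
    exact norm_Kop_le hα hθ hx₀ le_rfl hσ ih hx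

lemma norm_Sseq_le {α θ x₀ σ : ℝ} (hα : 0 < α) (hθ : 0 < θ) (hx₀ : 0 < x₀) (hσ : σ ≤ 0)
    (n : ℕ) {x : ℝ} (hx : x ∈ Ici x₀) : ‖Sseq α θ x₀ σ n x‖ ≤ (Mtail α θ x₀ / 2) ^ n := by
  have hM := Mtail_nonneg α θ x₀
  refine (norm_Sseq_le_mul_exp hα hθ hx₀ hσ n x hx).trans
    (mul_le_of_le_one_right (by positivity) (Real.exp_le_one_iff.2 ?_))
  nlinarith [phase_nonneg hα hθ (hx₀.le.trans hx)]

lemma continuousOn_Sseq {α θ x₀ σ : ℝ} (hα : 0 < α) (hθ : 0 < θ) (hx₀ : 0 < x₀) (hσ : σ ≤ 0)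
    (n : ℕ) : ContinuousOn (Sseq α θ x₀ σ n) (Ici x₀) := by
  induction n with
  | zero =>
    have hφ := continuous_phase hα hθ
    exact Continuous.continuousOn (by unfold Sseq; fun_prop)
  | succ n ih =>
    exact continuousOn_Kop hα hθ
      (integrableOn_Mfun_mul hα hθ hx₀ ih fun x hx => norm_Sseq_le hα hθ hx₀ hσ n hx)

lemma Kop_sum_Sseq {α θ x₀ σ x : ℝ} (hα : 0 < α) (hθ : 0 < θ) (hx₀ : 0 < x₀) (hσ : σ ≤ 0)
    (hx : x₀ ≤ x) (N : ℕ) :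
    Kop α θ x₀ σ (fun y => ∑ n ∈ Finset.range N, Sseq α θ x₀ σ n y) x =
      ∑ n ∈ Finset.range N, Sseq α θ x₀ σ (n + 1) x := by
  have hint : ∀ n, IntegrableOn (fun y => (Mfun α θ y : ℂ) * Sseq α θ x₀ σ n y) (Ioi x₀) :=
    fun n => integrableOn_Mfun_mul hα hθ hx₀ (continuousOn_Sseq hα hθ hx₀ hσ n)
      fun y hy => norm_Sseq_le hα hθ hx₀ hσ n hy
  induction N with
  | zero => simp [Kop]
  | succ N ih =>
    simp only [Finset.sum_range_succ]
    rw [Kop_add hα hθ ?_ (hint N) hx, ih, Sseq]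
    simp only [Finset.mul_sum]
    exact integrable_finsetSum _ fun n _ => hint n

/-- When `M_{x₀} < 2`, the operator `K_σ` has no nonzero bounded fixed point. -/
lemma eq_zero_of_eq_Kop {α θ x₀ σ C : ℝ} {f : ℝ → ℂ} (hα : 0 < α) (hθ : 0 < θ) (hx₀ : 0 < x₀)
    (hM : Mtail α θ x₀ < 2) (hσ : σ ≤ 0) (hC : ∀ x ∈ Ici x₀, ‖f x‖ ≤ C)
    (hf : ∀ x ∈ Ici x₀, f x = Kop α θ x₀ σ f x) {x : ℝ} (hx : x ∈ Ici x₀) : f x = 0 := by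
  have h : ∀ n : ℕ, ∀ x ∈ Ici x₀, ‖f x‖ ≤ (Mtail α θ x₀ / 2) ^ n * C := by
    intro n
    induction n with
    | zero => simpa using hC
    | succ n ih =>
      intro x hx
      rw [hf x hx, pow_succ', mul_assoc]
      simpa using norm_Kop_le (τ := 0) hα hθ hx₀ hσ le_rfl (by simpa using ih) hx
  have hlim : Tendsto (fun n : ℕ => (Mtail α θ x₀ / 2) ^ n * C) atTop (𝓝 (0 * C)) :=
    (tendsto_pow_atTop_nhds_zero_of_lt_one (by linarith [Mtail_nonneg α θ x₀])
      (by linarith)).mul_const C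
  rw [zero_mul] at hlim
  exact norm_le_zero_iff.1 (ge_of_tendsto' hlim fun n => h n x hx)

/-- convergence of the Volterra series and uniqueness of the solution. -/
theorem stmt3 (α θ x₀ σ : ℝ) (hα : 0 < α) (hθ : 0 < θ) (hx₀ : 0 < x₀)
    (hM : Mtail α θ x₀ < 2) (hσ : σ ≤ 0) (A : ℂ) :
    (∀ n : ℕ, ∀ x ∈ Ici x₀, ‖Sseq α θ x₀ σ n x‖ ≤ (Mtail α θ x₀ / 2) ^ n) ∧
    TendstoUniformlyOn
      (fun N : ℕ => fun x => ∑ n ∈ Finset.range N, Sseq α θ x₀ σ n x)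
      (fun x => ∑' n : ℕ, Sseq α θ x₀ σ n x) atTop (Ici x₀) ∧
    (∀ S : ℝ → ℂ, (∃ C, ∀ x ∈ Ici x₀, ‖S x‖ ≤ C) → ContinuousOn S (Ici x₀) →
      (∀ x ∈ Ici x₀,
        S x = A * Complex.exp (-2 * Complex.I * (1 + Complex.I * (σ : ℂ)) * (phase α θ x : ℂ)) +
          Kop α θ x₀ σ S x) →
      ∀ x ∈ Ici x₀, S x = A * ∑' n : ℕ, Sseq α θ x₀ σ n x) ∧
    ((∃ C, ∀ x ∈ Ici x₀, ‖A * ∑' n : ℕ, Sseq α θ x₀ σ n x‖ ≤ C) ∧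
      ContinuousOn (fun x => A * ∑' n : ℕ, Sseq α θ x₀ σ n x) (Ici x₀) ∧
      ∀ x ∈ Ici x₀,
        A * ∑' n : ℕ, Sseq α θ x₀ σ n x =
          A * Complex.exp (-2 * Complex.I * (1 + Complex.I * (σ : ℂ)) * (phase α θ x : ℂ)) +
            Kop α θ x₀ σ (fun y => A * ∑' n : ℕ, Sseq α θ x₀ σ n y) x) ∧
    (∀ n : ℕ, ∀ x ∈ Ici x₀,
      ‖Sseq α θ x₀ σ n x *
          Complex.exp (2 * Complex.I * (1 + Complex.I * (σ : ℂ)) * (phase α θ x : ℂ))‖ ≤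
        (Mtail α θ x₀ / 2) ^ n) ∧
    (∀ N : ℕ, ∀ x ∈ Ici x₀,
      ‖∑' n : ℕ, Sseq α θ x₀ σ (N + 1 + n) x *
          Complex.exp (2 * Complex.I * (1 + Complex.I * (σ : ℂ)) * (phase α θ x : ℂ))‖ ≤
        (1 - Mtail α θ x₀ / 2)⁻¹ * (Mtail α θ x₀ / 2) ^ (N + 1)) := by
  have hM0 := Mtail_nonneg α θ x₀
  set q := Mtail α θ x₀ / 2 with hq
  have hq0 : 0 ≤ q := by positivity
  have hq1 : q < 1 := by linarith
  have hgeo := summable_geometric_of_lt_one hq0 hq1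
  have hS : ∀ n : ℕ, ∀ x ∈ Ici x₀, ‖Sseq α θ x₀ σ n x‖ ≤ q ^ n := fun n x hx =>
    norm_Sseq_le hα hθ hx₀ hσ n hx
  have hcS := continuousOn_Sseq (x₀ := x₀) hα hθ hx₀ hσ
  have hunif := tendstoUniformlyOn_tsum_nat hgeo hS
  have hTc : ContinuousOn (fun x => ∑' n : ℕ, Sseq α θ x₀ σ n x) (Ici x₀) :=
    continuousOn_tsum hcS hgeo hS
  have hsum : ∀ x ∈ Ici x₀, Summable fun n => Sseq α θ x₀ σ n x := fun x hx =>
    Summable.of_norm_bounded hgeo fun n => hS n x hx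
  have hTb : ∀ x ∈ Ici x₀, ‖∑' n : ℕ, Sseq α θ x₀ σ n x‖ ≤ (1 - q)⁻¹ := fun x hx =>
    tsum_of_norm_bounded (hasSum_geometric_of_lt_one hq0 hq1) fun n => hS n x hx
  have hTi := integrableOn_Mfun_mul hα hθ hx₀ hTc hTb
  have hKT : ∀ x ∈ Ici x₀, Kop α θ x₀ σ (fun y => ∑' n : ℕ, Sseq α θ x₀ σ n y) x =
      ∑' n : ℕ, Sseq α θ x₀ σ (n + 1) x := by
    intro x hx
    refine tendsto_nhds_unique ?_ ((summable_nat_add_iff 1).2 (hsum x hx)).hasSum.tendsto_sum_nat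
    simp_rw [← Kop_sum_Sseq hα hθ hx₀ hσ hx]
    rw [Metric.tendsto_atTop]
    intro ε hε
    rw [Metric.tendstoUniformlyOn_iff] at hunif
    obtain ⟨N₀, hN₀⟩ := eventually_atTop.1 (hunif ε hε)
    refine ⟨N₀, fun N hN => ?_⟩
    have hPi : IntegrableOn (fun y => (Mfun α θ y : ℂ) *
        ∑ n ∈ Finset.range N, Sseq α θ x₀ σ n y) (Ioi x₀) :=
      integrableOn_Mfun_mul hα hθ hx₀ (continuousOn_finsetSum _ fun n _ => hcS n)
        fun y hy => norm_sum_le_of_le _ fun n _ => hS n y hy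
    rw [dist_comm, dist_eq_norm, ← Kop_sub hα hθ hTi hPi hx]
    have hle := norm_Kop_le (σ := σ) (τ := 0) (C := ε) hα hθ hx₀ hσ le_rfl
      (f := fun y => ∑' n : ℕ, Sseq α θ x₀ σ n y - ∑ n ∈ Finset.range N, Sseq α θ x₀ σ n y)
      (fun y hy => by simpa [dist_eq_norm] using (hN₀ N hN y hy).le) hx
    rw [mul_zero, zero_mul, Real.exp_zero, mul_one] at hle
    exact hle.trans_lt (mul_lt_of_lt_one_left hε hq1)
  have hTA : ∀ x ∈ Ici x₀, A * ∑' n : ℕ, Sseq α θ x₀ σ n x =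
      A * Complex.exp (-2 * Complex.I * (1 + Complex.I * (σ : ℂ)) * (phase α θ x : ℂ)) +
        Kop α θ x₀ σ (fun y => A * ∑' n : ℕ, Sseq α θ x₀ σ n y) x := by
    intro x hx
    rw [Kop_const_mul, hKT x hx, (hsum x hx).tsum_eq_zero_add, Sseq, mul_add]
  have hAb : ∀ x ∈ Ici x₀, ‖A * ∑' n : ℕ, Sseq α θ x₀ σ n x‖ ≤ ‖A‖ * (1 - q)⁻¹ := by
    intro x hx
    rw [norm_mul]
    gcongr
    exact hTb x hx
  have hs : ∀ n : ℕ, ∀ x ∈ Ici x₀, ‖Sseq α θ x₀ σ n x *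
      Complex.exp (2 * Complex.I * (1 + Complex.I * (σ : ℂ)) * (phase α θ x : ℂ))‖ ≤ q ^ n := by
    intro n x hx
    have he : ‖Complex.exp (2 * Complex.I * (1 + Complex.I * (σ : ℂ)) * (phase α θ x : ℂ))‖ =
        (Real.exp (2 * σ * phase α θ x))⁻¹ := by
      rw [← norm_exp_phase, ← norm_inv, ← Complex.exp_neg]
      ring_nf
    rw [norm_mul, he, ← div_eq_mul_inv, div_le_iff₀ (Real.exp_pos _)]
    exact norm_Sseq_le_mul_exp hα hθ hx₀ hσ n x hx
  have hAc : ContinuousOn (fun x => A * ∑' n : ℕ, Sseq α θ x₀ σ n x) (Ici x₀) :=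
    continuousOn_const.mul hTc
  refine ⟨hS, hunif, ?_, ⟨⟨_, hAb⟩, hAc, hTA⟩, hs, ?_⟩
  · rintro S ⟨C, hC⟩ hSc hSeq x hx
    refine sub_eq_zero.1 (eq_zero_of_eq_Kop (C := C + ‖A‖ * (1 - q)⁻¹)
      (f := fun y => S y - A * ∑' n : ℕ, Sseq α θ x₀ σ n y) hα hθ hx₀ hM hσ
      (fun y hy => (norm_sub_le _ _).trans (add_le_add (hC y hy) (hAb y hy))) ?_ hx)
    intro y hy
    rw [Kop_sub hα hθ (integrableOn_Mfun_mul hα hθ hx₀ hSc hC)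
      (integrableOn_Mfun_mul hα hθ hx₀ hAc hAb) hy]
    linear_combination hSeq y hy - hTA y hy
  · intro N x hx
    refine tsum_of_norm_bounded ?_ fun n => hs (N + 1 + n) x hx
    simp_rw [pow_add _ (N + 1)]
    rw [mul_comm]
    exact (hasSum_geometric_of_lt_one hq0 hq1).mul_left _
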